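/- Let r ≥ 1 be an integer and let t be a complex number with |t| < 1. Then the family (n₁,n₃) ↦ t^{(4r−4)(n₁−n₃)+|n₁|+2|n₃|} indexed by pairs of integers n₁ > n₃ is absolutely summable and Σ_{n₁>n₃∈ℤ} t^{(4r−4)(n₁−n₃)+|n₁|+2|n₃|} = t^{4r−3}/((1−t³)(1−t^{4r−3})) + t^{4r−2}/((1−t³)(1−t^{4r−2})) + t^{8r−5}/((1−t^{4r−3})(1−t^{4r−2})). -/

import Mathlib

def monoMap : (ℕ × ℕ) ⊕ ((ℕ × ℕ) ⊕ (ℕ × ℕ)) → {p : ℤ × ℤ // p.2 < p.1}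
  | Sum.inl (m, k) => ⟨((m : ℤ) + 1 + k, (m : ℤ)), by simp only; omega⟩
  | Sum.inr (Sum.inl (m, k)) => ⟨(-(m : ℤ), -(m : ℤ) - 1 - k), by simp only; omega⟩
  | Sum.inr (Sum.inr (a, b)) => ⟨((a : ℤ) + 1, -(b : ℤ) - 1), by simp only; omega⟩

lemma monoMap_bij : Function.Bijective monoMap := by
  constructor
  · rintro (⟨a, b⟩ | ⟨a, b⟩ | ⟨a, b⟩) (⟨c, d⟩ | ⟨c, d⟩ | ⟨c, d⟩) h <;>
      simp only [monoMap, Subtype.mk.injEq, Prod.mk.injEq] at h <;>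
      simp only [Sum.inl.injEq, Sum.inr.injEq, Prod.mk.injEq, reduceCtorEq] <;> omega
  · rintro ⟨⟨x, y⟩, h⟩
    simp only at h
    by_cases hy : 0 ≤ y
    · refine ⟨Sum.inl (y.toNat, (x - y - 1).toNat), ?_⟩
      simp only [monoMap, Subtype.mk.injEq, Prod.mk.injEq]
      omega
    · by_cases hx : x ≤ 0
      · refine ⟨Sum.inr (Sum.inl ((-x).toNat, (x - y - 1).toNat)), ?_⟩
        simp only [monoMap, Subtype.mk.injEq, Prod.mk.injEq]
        omega
      · refine ⟨Sum.inr (Sum.inr ((x - 1).toNat, (-y - 1).toNat)), ?_⟩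
        simp only [monoMap, Subtype.mk.injEq, Prod.mk.injEq]
        omega

lemma hasSum_geom_two (c x y : ℂ) (hx : ‖x‖ < 1) (hy : ‖y‖ < 1) :
    HasSum (fun p : ℕ × ℕ => c * (x ^ p.1 * y ^ p.2)) (c / ((1 - x) * (1 - y))) := by
  have h1 := hasSum_geometric_of_norm_lt_one hx
  have h2 := hasSum_geometric_of_norm_lt_one hy
  have h := h1.mul h2 (summable_mul_of_summable_norm
    (summable_norm_geometric_of_norm_lt_one hx) (summable_norm_geometric_of_norm_lt_one hy))
  have := h.mul_left c
  rwa [← mul_inv, ← div_eq_mul_inv] at this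

lemma monopole_hasSum (r : ℕ) (hr : 1 ≤ r) (t : ℂ) (ht : ‖t‖ < 1) :
    HasSum (fun p : {p : ℤ × ℤ // p.2 < p.1} =>
        t ^ ((4 * (r : ℤ) - 4) * (p.1.1 - p.1.2) + |p.1.1| + 2 * |p.1.2|))
      (t ^ (4 * r - 3) / ((1 - t ^ 3) * (1 - t ^ (4 * r - 3)))
        + (t ^ (4 * r - 2) / ((1 - t ^ 3) * (1 - t ^ (4 * r - 2)))
        + t ^ (8 * r - 5) / ((1 - t ^ (4 * r - 3)) * (1 - t ^ (4 * r - 2))))) := by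
  obtain ⟨s, rfl⟩ : ∃ s, r = s + 1 := ⟨r - 1, by omega⟩
  have e1 : 4 * (s + 1) - 3 = 4 * s + 1 := by omega
  have e2 : 4 * (s + 1) - 2 = 4 * s + 2 := by omega
  have e3 : 8 * (s + 1) - 5 = 8 * s + 3 := by omega
  rw [e1, e2, e3]
  have hp : ∀ n : ℕ, n ≠ 0 → ‖t ^ n‖ < 1 := fun n hn => by
    rw [norm_pow]; exact pow_lt_one₀ (norm_nonneg _) ht hn
  rw [← (Equiv.ofBijective monoMap monoMap_bij).hasSum_iff]
  refine HasSum.sum (f := _) ?_ (HasSum.sum ?_ ?_)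
  · convert hasSum_geom_two (t ^ (4 * s + 1)) (t ^ 3) (t ^ (4 * s + 1)) (hp _ (by omega))
      (hp _ (by omega)) using 2 with p
    obtain ⟨m, k⟩ := p
    simp only [Function.comp, Equiv.ofBijective_apply, monoMap]
    rw [abs_of_nonneg (by omega), abs_of_nonneg (by omega), ← pow_mul, ← pow_mul, ← pow_add,
      ← pow_add, ← zpow_natCast]
    congr 1; push_cast; ring
  · convert hasSum_geom_two (t ^ (4 * s + 2)) (t ^ 3) (t ^ (4 * s + 2)) (hp _ (by omega))
      (hp _ (by omega)) using 2 with p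
    obtain ⟨m, k⟩ := p
    simp only [Function.comp, Equiv.ofBijective_apply, monoMap]
    rw [abs_of_nonpos (by omega), abs_of_nonpos (by omega), ← pow_mul, ← pow_mul, ← pow_add,
      ← pow_add, ← zpow_natCast]
    congr 1; push_cast; ring
  · convert hasSum_geom_two (t ^ (8 * s + 3)) (t ^ (4 * s + 1)) (t ^ (4 * s + 2))
      (hp _ (by omega)) (hp _ (by omega)) using 2 with p
    obtain ⟨m, k⟩ := p
    simp only [Function.comp, Equiv.ofBijective_apply, monoMap]
    rw [abs_of_nonneg (by omega), abs_of_nonpos (by omega), ← pow_mul, ← pow_mul, ← pow_add,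
      ← pow_add, ← zpow_natCast]
    congr 1; push_cast; ring


/-- A partial sum of the monopole formula for the Coulomb branch `M_C(r,3,1)`
(coweights `n₁ ≥ n₂ = n₃`): for `|t| < 1`, the family
`t^{(4r−4)(n₁−n₃)+|n₁|+2|n₃|}` over pairs of integers `n₁ > n₃` is absolutely summable
and its sum equals `t^{4r−3}/((1−t³)(1−t^{4r−3})) + t^{4r−2}/((1−t³)(1−t^{4r−2}))
+ t^{8r−5}/((1−t^{4r−3})(1−t^{4r−2}))`. -/
theorem monopole_sum_subregular_rank_three (r : ℕ) (hr : 1 ≤ r) (t : ℂ) (ht : ‖t‖ < 1) :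
    Summable (fun p : {p : ℤ × ℤ // p.2 < p.1} =>
      ‖t ^ ((4 * (r : ℤ) - 4) * (p.1.1 - p.1.2) + |p.1.1| + 2 * |p.1.2|)‖) ∧
    ∑' p : {p : ℤ × ℤ // p.2 < p.1},
        t ^ ((4 * (r : ℤ) - 4) * (p.1.1 - p.1.2) + |p.1.1| + 2 * |p.1.2|) =
      t ^ (4 * r - 3) / ((1 - t ^ 3) * (1 - t ^ (4 * r - 3)))
        + t ^ (4 * r - 2) / ((1 - t ^ 3) * (1 - t ^ (4 * r - 2)))
        + t ^ (8 * r - 5) / ((1 - t ^ (4 * r - 3)) * (1 - t ^ (4 * r - 2))) := by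
  have h := monopole_hasSum r hr t ht
  exact ⟨h.summable.norm, by rw [h.tsum_eq, add_assoc]⟩
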